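/- (Extraction of a rich low-volume subfamily; abstract form of Lemma 1.2.) Let d ≥ 3 and K̄ ≥ 1. Suppose Ã ⊆ Z^d is a finite union of boxes B_0 of side L_0, whose base points are at mutual sup-norm distance at least K̄ L_0. Then (for K̄, and the scales, large enough depending only on d) there exists a union of such boxes A' ⊆ Ã with cap(A') ≥ c · cap(Ã) and |A'|/|B_0| ≤ c' · cap(Ã)/cap(B_0), for constants c, c' > 0 depending only on d. -/

import Mathlib

open scoped Classical
open Filter

noncomputable section

abbrev V (d : ℕ) := Fin d → ℤ

variable {d : ℕ}

/-- sup-norm of a lattice point. -/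
def supNorm (x : V d) : ℕ := Finset.univ.sup fun i => (x i).natAbs

/-- ℓ¹-norm of a lattice point. -/
def l1Norm (x : V d) : ℕ := ∑ i, (x i).natAbs

/-- Euclidean norm of a lattice point. -/
def eNorm (x : V d) : ℝ := Real.sqrt (∑ i, ((x i : ℝ)) ^ 2)

/-- closed sup-norm ball `B(x,r)` as a `Finset`. -/
def ball (x : V d) (r : ℤ) : Finset (V d) := Fintype.piFinset fun i => Finset.Icc (x i - r) (x i + r)

/-- box of side `L` with base point `x`. -/
def box (x : V d) (L : ℤ) : Finset (V d) := Fintype.piFinset fun i => Finset.Ico (x i) (x i + L)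

/-- nearest neighbours of `x` in `ℤ^d`. -/
def nbrs (x : V d) : Finset (V d) :=
  (Finset.univ : Finset (Fin d × Bool)).image
    fun p => Function.update x p.1 (x p.1 + if p.2 then 1 else -1)

/-- `n`-step transition probability of the simple random walk on `ℤ^d`. -/
def step (d : ℕ) : ℕ → V d → V d → ℝ
  | 0, x, y => if x = y then 1 else 0
  | n+1, x, y => ∑ z ∈ nbrs x, (1 / (2 * (d : ℝ))) * step d n z y

/-- Green function of the simple random walk on `ℤ^d` (`d ≥ 3`); for the
continuous-time walk with unit jump rate it coincides with the expected number of
visits of the discrete-time walk. -/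
def green (x y : V d) : ℝ := ∑' n, step d n x y

/-- `n`-step transition probability of the walk killed outside `U`. -/
def stepK (d : ℕ) (U : Set (V d)) : ℕ → V d → V d → ℝ
  | 0, x, y => if x = y ∧ x ∈ U then 1 else 0
  | n+1, x, y => if x ∈ U then ∑ z ∈ nbrs x, (1 / (2 * (d : ℝ))) * stepK d U n z y else 0

/-- Green function of the walk killed outside `U`. -/
def greenK (U : Set (V d)) (x y : V d) : ℝ := ∑' n, stepK d U n x y

/-- probability of entering `F` within `n` steps and before exiting `U`. -/
def hitBE (F : Finset (V d)) (U : Set (V d)) : ℕ → V d → ℝ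
  | 0, x => if x ∈ F then 1 else 0
  | n+1, x => if x ∈ F then 1 else
      if x ∈ U then ∑ z ∈ nbrs x, (1 / (2 * (d : ℝ))) * hitBE F U n z else 0

/-- `P_x[H_F < T_U]`. -/
def hitBeforeExit (F : Finset (V d)) (U : Set (V d)) (x : V d) : ℝ := ⨆ n, hitBE F U n x

/-- `P_x[H_F < ∞]`. -/
def hitProb (F : Finset (V d)) (x : V d) : ℝ := hitBeforeExit F Set.univ x

/-- equilibrium measure `e_A(x) = P_x[H̃_A = ∞] 1_A(x)`. -/
def eqm (A : Finset (V d)) (x : V d) : ℝ :=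
  if x ∈ A then ∑ z ∈ nbrs x, (1 / (2 * (d : ℝ))) * (1 - hitProb A z) else 0

/-- capacity of a finite set. -/
def capa (A : Finset (V d)) : ℝ := ∑ x ∈ A, eqm A x

/-- local density `σ_m(x)` of `U₁` in `B(x, 2^m L₁)`. -/
def dens (U₁ : Set (V d)) (L₁ : ℤ) (m : ℕ) (x : V d) : ℝ :=
  (((ball x (2 ^ m * L₁)).filter (· ∈ U₁)).card : ℝ) / ((ball x (2 ^ m * L₁)).card : ℝ)

/-- average of `f` over `B(x,r)` w.r.t. the normalized counting measure. -/
def ballAvg (x : V d) (r : ℤ) (f : V d → ℝ) : ℝ :=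
  (∑ y ∈ ball x r, f y) / ((ball x r).card : ℝ)

/-- `m_{x,r}`-measure of `{y : P y}`. -/
def frac (x : V d) (r : ℤ) (P : V d → Prop) : ℝ :=
  (((ball x r).filter P).card : ℝ) / ((ball x r).card : ℝ)

/-! ### The transition operator and the Green function -/

lemma mem_nbrs_iff {x y : V d} :
    y ∈ nbrs x ↔ ∃ i : Fin d, ∃ b : Bool, Function.update x i (x i + if b then 1 else -1) = y := by
  simp [nbrs]

lemma mem_nbrs_symm {x y : V d} (h : y ∈ nbrs x) : x ∈ nbrs y := by
  obtain ⟨i, b, rfl⟩ := mem_nbrs_iff.1 h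
  refine mem_nbrs_iff.2 ⟨i, !b, ?_⟩
  cases b <;> simp

lemma mem_nbrs_comm {x y : V d} : y ∈ nbrs x ↔ x ∈ nbrs y :=
  ⟨mem_nbrs_symm, mem_nbrs_symm⟩

lemma card_nbrs (x : V d) : (nbrs x).card = 2 * d := by
  rw [nbrs, Finset.card_image_of_injective]
  · simp [mul_comm]
  · rintro ⟨i, b⟩ ⟨j, b'⟩ h
    have hi := congrFun h i
    by_cases hij : i = j
    · subst hij
      cases b <;> cases b' <;> simp at hi ⊢
    · cases b <;> simp [Function.update_of_ne hij] at hi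

lemma nbrs_add (x w : V d) : nbrs (x + w) = (nbrs x).image (· + w) := by
  ext y
  simp only [Finset.mem_image, mem_nbrs_iff]
  constructor
  · rintro ⟨i, b, rfl⟩
    refine ⟨_, ⟨i, b, rfl⟩, ?_⟩
    ext j
    by_cases h : j = i
    · subst h; simp; ring
    · simp [Function.update_of_ne h]
  · rintro ⟨_, ⟨i, b, rfl⟩, rfl⟩
    refine ⟨i, b, ?_⟩
    ext j
    by_cases h : j = i
    · subst h; simp; ring
    · simp [Function.update_of_ne h]

/-- The transition operator of the simple random walk. -/
def walkAvg (f : V d → ℝ) (x : V d) : ℝ := ∑ z ∈ nbrs x, (1 / (2 * (d : ℝ))) * f z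

lemma walkAvg_mono {f g : V d → ℝ} (h : ∀ x, f x ≤ g x) (x : V d) : walkAvg f x ≤ walkAvg g x :=
  Finset.sum_le_sum fun z _ => mul_le_mul_of_nonneg_left (h z) (by positivity)

lemma walkAvg_const (hd : d ≠ 0) (a : ℝ) (x : V d) : walkAvg (fun _ => a) x = a := by
  have : (d : ℝ) ≠ 0 := by exact_mod_cast hd
  simp only [walkAvg, Finset.sum_const, card_nbrs, nsmul_eq_mul]
  push_cast
  field_simp

lemma walkAvg_nonneg {f : V d → ℝ} (h : ∀ x, 0 ≤ f x) (x : V d) : 0 ≤ walkAvg f x :=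
  Finset.sum_nonneg fun z _ => mul_nonneg (by positivity) (h z)

lemma walkAvg_sub (f g : V d → ℝ) (x : V d) :
    walkAvg (fun z => f z - g z) x = walkAvg f x - walkAvg g x := by
  simp only [walkAvg, mul_sub, Finset.sum_sub_distrib]

lemma walkAvg_sum_mul {ι : Type*} (s : Finset ι) (f : ι → V d → ℝ) (a : ι → ℝ) (x : V d) :
    walkAvg (fun z => ∑ i ∈ s, f i z * a i) x = ∑ i ∈ s, walkAvg (f i) x * a i := by
  simp only [walkAvg, Finset.mul_sum, Finset.sum_mul]
  rw [Finset.sum_comm]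
  exact Finset.sum_congr rfl fun _ _ => Finset.sum_congr rfl fun _ _ => by ring

lemma hasSum_walkAvg {f : ℕ → V d → ℝ} {g : V d → ℝ} (h : ∀ z, HasSum (fun n => f n z) (g z))
    (x : V d) : HasSum (fun n => walkAvg (f n) x) (walkAvg g x) :=
  hasSum_sum fun z _ => (h z).mul_left _

lemma step_succ (n : ℕ) (x y : V d) : step d (n + 1) x y = walkAvg (fun z => step d n z y) x := rfl

lemma step_nonneg (n : ℕ) : ∀ x y : V d, 0 ≤ step d n x y := by
  induction n with
  | zero => intro x y; simp only [step]; split_ifs <;> norm_num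
  | succ n ih => intro x y; exact walkAvg_nonneg (fun z => ih z y) x

lemma step_succ_right (n : ℕ) :
    ∀ x y : V d, step d (n + 1) x y = ∑ w ∈ nbrs y, (1 / (2 * (d : ℝ))) * step d n x w := by
  induction n with
  | zero => intro x y; simp [step, mem_nbrs_comm (x := x) (y := y)]
  | succ n ih =>
    intro x y
    calc step d (n + 2) x y
        = ∑ z ∈ nbrs x, ∑ w ∈ nbrs y, 1 / (2 * (d : ℝ)) * (1 / (2 * (d : ℝ)) * step d n z w) := by
          rw [step]
          simp only [ih, Finset.mul_sum]
      _ = ∑ w ∈ nbrs y, 1 / (2 * (d : ℝ)) * step d (n + 1) x w := by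
          rw [Finset.sum_comm]
          simp only [step, Finset.mul_sum]

lemma step_comm (n : ℕ) : ∀ x y : V d, step d n x y = step d n y x := by
  induction n with
  | zero => intro x y; simp [step, eq_comm]
  | succ n ih =>
    intro x y
    rw [step_succ_right, step]
    exact Finset.sum_congr rfl fun z _ => by rw [ih]

lemma step_add_right (n : ℕ) : ∀ x y w : V d, step d n (x + w) (y + w) = step d n x y := by
  induction n with
  | zero => intro x y w; simp [step]
  | succ n ih =>
    intro x y w
    rw [step, step, nbrs_add, Finset.sum_image fun a _ b _ h => add_right_cancel h]
    exact Finset.sum_congr rfl fun z _ => by rw [ih]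

lemma green_nonneg (x y : V d) : 0 ≤ green x y := tsum_nonneg fun n => step_nonneg n x y

lemma green_comm (x y : V d) : green x y = green y x := by
  simp only [green, step_comm _ x y]

lemma green_add_right (x y w : V d) : green (x + w) (y + w) = green x y := by
  simp only [green, step_add_right]

/-- Transience of the walk, as finiteness of the Green function. -/
def Transient (d : ℕ) : Prop := ∀ x y : V d, Summable fun n => step d n x y

lemma Transient.hasSum_tail (hS : Transient d) (N : ℕ) (x y : V d) :
    HasSum (fun n => step d (n + N) x y) (∑' n, step d (n + N) x y) :=
  ((summable_nat_add_iff N).2 (hS x y)).hasSum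

lemma Transient.walkAvg_tail (hS : Transient d) (N : ℕ) (x y : V d) :
    walkAvg (fun z => ∑' n, step d (n + N) z y) x = ∑' n, step d (n + (N + 1)) x y :=
  (hasSum_walkAvg (fun z => hS.hasSum_tail N z y) x).tsum_eq.symm

lemma Transient.green_eq (hS : Transient d) (x y : V d) :
    green x y = (if x = y then 1 else 0) + walkAvg (fun z => green z y) x := by
  have h := hS.walkAvg_tail 0 x y
  simp only [add_zero] at h
  change _ = _ + walkAvg (fun z => ∑' n, step d n z y) x
  rw [h, green, (hS x y).tsum_eq_zero_add]
  simp [step]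

lemma Transient.one_le_green_self (hS : Transient d) (x : V d) : 1 ≤ green x x := by
  rw [hS.green_eq, if_pos rfl]
  linarith [walkAvg_nonneg (fun z => green_nonneg z x) x]

/-! ### Hitting probabilities, equilibrium measure and capacity -/

lemma hitBE_univ_succ (A : Finset (V d)) (n : ℕ) (x : V d) :
    hitBE A Set.univ (n + 1) x = if x ∈ A then 1 else walkAvg (hitBE A Set.univ n) x := by
  simp [hitBE, walkAvg]

lemma hitBE_univ_of_mem {A : Finset (V d)} {x : V d} (hx : x ∈ A) (n : ℕ) :
    hitBE A Set.univ n x = 1 := by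
  cases n <;> simp [hitBE, hx]

lemma hitBE_univ_nonneg (A : Finset (V d)) (n : ℕ) : ∀ x, 0 ≤ hitBE A Set.univ n x := by
  induction n with
  | zero => intro x; simp only [hitBE]; split_ifs <;> norm_num
  | succ n ih =>
    intro x
    rw [hitBE_univ_succ]
    split_ifs
    exacts [zero_le_one, walkAvg_nonneg ih x]

lemma hitBE_univ_le_one (hd : d ≠ 0) (A : Finset (V d)) (n : ℕ) :
    ∀ x, hitBE A Set.univ n x ≤ 1 := by
  induction n with
  | zero => intro x; simp only [hitBE]; split_ifs <;> norm_num
  | succ n ih =>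
    intro x
    rw [hitBE_univ_succ]
    split_ifs
    exacts [le_rfl, (walkAvg_mono ih x).trans_eq (walkAvg_const hd 1 x)]

lemma hitBE_univ_le_succ (A : Finset (V d)) (n : ℕ) :
    ∀ x, hitBE A Set.univ n x ≤ hitBE A Set.univ (n + 1) x := by
  induction n with
  | zero =>
    intro x
    by_cases hx : x ∈ A
    · simp [hitBE_univ_of_mem hx]
    · simpa [hitBE, hx] using hitBE_univ_nonneg A 1 x
  | succ n ih =>
    intro x
    rw [hitBE_univ_succ, hitBE_univ_succ A (n + 1)]
    split_ifs
    exacts [le_rfl, walkAvg_mono ih x]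

lemma bddAbove_hitBE (hd : d ≠ 0) (A : Finset (V d)) (x : V d) :
    BddAbove (Set.range fun n => hitBE A Set.univ n x) :=
  ⟨1, by rintro _ ⟨n, rfl⟩; exact hitBE_univ_le_one hd A n x⟩

lemma tendsto_hitBE (hd : d ≠ 0) (A : Finset (V d)) (x : V d) :
    Tendsto (fun n => hitBE A Set.univ n x) atTop (nhds (hitProb A x)) :=
  tendsto_atTop_ciSup (monotone_nat_of_le_succ fun n => hitBE_univ_le_succ A n x)
    (bddAbove_hitBE hd A x)

lemma hitProb_le_one (hd : d ≠ 0) (A : Finset (V d)) (x : V d) : hitProb A x ≤ 1 :=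
  ciSup_le fun n => hitBE_univ_le_one hd A n x

lemma hitProb_nonneg (hd : d ≠ 0) (A : Finset (V d)) (x : V d) : 0 ≤ hitProb A x :=
  (hitBE_univ_nonneg A 0 x).trans (le_ciSup (bddAbove_hitBE hd A x) 0)

lemma hitProb_of_mem {A : Finset (V d)} {x : V d} (hx : x ∈ A) : hitProb A x = 1 := by
  simp [hitProb, hitBeforeExit, hitBE_univ_of_mem hx]

lemma hitProb_of_notMem (hd : d ≠ 0) {A : Finset (V d)} {x : V d} (hx : x ∉ A) :
    hitProb A x = walkAvg (hitProb A) x := by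
  have h1 := (tendsto_hitBE hd A x).comp (tendsto_add_atTop_nat 1)
  have h2 : Tendsto (fun n => walkAvg (hitBE A Set.univ n) x) atTop
      (nhds (walkAvg (hitProb A) x)) :=
    tendsto_finsetSum _ fun z _ => (tendsto_hitBE hd A z).const_mul _
  refine tendsto_nhds_unique h1 (h2.congr fun n => ?_)
  simp [hitBE_univ_succ, hx]

lemma eqm_nonneg (hd : d ≠ 0) (A : Finset (V d)) (x : V d) : 0 ≤ eqm A x := by
  rw [eqm]
  split_ifs
  · exact Finset.sum_nonneg fun z _ =>
      mul_nonneg (by positivity) (sub_nonneg.2 (hitProb_le_one hd A z))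
  · exact le_rfl

lemma capa_nonneg (hd : d ≠ 0) (A : Finset (V d)) : 0 ≤ capa A :=
  Finset.sum_nonneg fun x _ => eqm_nonneg hd A x

lemma hitProb_eq_eqm_add (hd : d ≠ 0) (A : Finset (V d)) (x : V d) :
    hitProb A x = eqm A x + walkAvg (hitProb A) x := by
  by_cases hx : x ∈ A
  · have h : eqm A x = walkAvg (fun z => 1 - hitProb A z) x := by simp [eqm, hx, walkAvg]
    rw [h, walkAvg_sub, walkAvg_const hd, hitProb_of_mem hx]
    ring
  · rw [hitProb_of_notMem hd hx]
    simp [eqm, hx, ← hitProb_of_notMem hd hx]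

lemma sum_ite_eq_mul_eqm (A : Finset (V d)) (x : V d) :
    ∑ y ∈ A, (if x = y then 1 else 0) * eqm A y = eqm A x := by
  by_cases hx : x ∈ A <;> simp [hx, eqm]

/-- Last-exit decomposition truncated at a finite time. -/
lemma sum_step_mul_eqm_le_hitProb (hd : d ≠ 0) (A : Finset (V d)) (N : ℕ) :
    ∀ x, ∑ y ∈ A, (∑ n ∈ Finset.range N, step d n x y) * eqm A y ≤ hitProb A x := by
  induction N with
  | zero => intro x; simpa using hitProb_nonneg hd A x
  | succ N ih =>
    intro x
    have h1 := walkAvg_mono ih x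
    rw [walkAvg_sum_mul] at h1
    rw [hitProb_eq_eqm_add hd, ← sum_ite_eq_mul_eqm]
    refine le_trans (le_of_eq ?_) (add_le_add_right h1 _)
    rw [← Finset.sum_add_distrib]
    refine Finset.sum_congr rfl fun y _ => ?_
    rw [← add_mul, Finset.sum_range_succ', add_comm]
    congr 2
    simp only [step_succ, walkAvg, Finset.mul_sum]
    exact Finset.sum_comm

/-- The walk is transient as soon as one finite set has positive capacity. -/
lemma transient_of_capa_pos (hd : d ≠ 0) {A : Finset (V d)} (hA : 0 < capa A) :
    Transient d := by
  obtain ⟨y, hy, hpos⟩ := Finset.exists_lt_of_sum_lt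
    (show ∑ _x ∈ A, (0 : ℝ) < ∑ x ∈ A, eqm A x by rw [Finset.sum_const_zero]; exact hA)
  have key : ∀ x, Summable fun n => step d n x y := fun x =>
    summable_of_sum_range_le (c := 1 / eqm A y) (fun n => step_nonneg n x y) fun N => by
      rw [le_div_iff₀ hpos]
      refine le_trans ?_ ((sum_step_mul_eqm_le_hitProb hd A N x).trans (hitProb_le_one hd A x))
      exact Finset.single_le_sum (f := fun y => (∑ n ∈ Finset.range N, step d n x y) * eqm A y)
        (fun z _ => mul_nonneg (Finset.sum_nonneg fun n _ => step_nonneg n x z)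
          (eqm_nonneg hd A z)) hy
  intro x z
  refine (key (x + (y - z))).congr fun n => ?_
  rw [← step_add_right n x z (y - z)]
  simp

lemma Transient.hitProb_le_sum_green (hS : Transient d) (A : Finset (V d)) (x : V d) :
    hitProb A x ≤ ∑ y ∈ A, green x y := by
  have hu : ∀ x, ∑ y ∈ A, green x y =
      (if x ∈ A then 1 else 0) + walkAvg (fun z => ∑ y ∈ A, green z y) x := by
    intro x
    have h := walkAvg_sum_mul A (fun y z => green z y) (fun _ => 1) x
    simp only [mul_one] at h
    rw [h, Finset.sum_congr rfl fun y _ => hS.green_eq x y, Finset.sum_add_distrib]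
    simp
  have hpos : ∀ x, 0 ≤ ∑ y ∈ A, green x y := fun x =>
    Finset.sum_nonneg fun y _ => green_nonneg x y
  have hmem : ∀ x ∈ A, 1 ≤ ∑ y ∈ A, green x y := by
    intro x hx
    rw [hu, if_pos hx]
    linarith [walkAvg_nonneg hpos x]
  refine ciSup_le fun n => ?_
  induction n generalizing x with
  | zero =>
    simp only [hitBE]
    split_ifs with hx
    exacts [hmem x hx, hpos x]
  | succ n ih =>
    rw [hitBE_univ_succ]
    split_ifs with hx
    · exact hmem x hx
    · rw [hu, if_neg hx, zero_add]
      exact walkAvg_mono ih x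

/-- Last-exit decomposition. -/
lemma Transient.sum_green_mul_eqm (hS : Transient d) (hd : d ≠ 0) (A : Finset (V d)) (x : V d) :
    ∑ y ∈ A, green x y * eqm A y = hitProb A x := by
  have hle : ∀ x, ∑ y ∈ A, green x y * eqm A y ≤ hitProb A x := fun x =>
    le_of_tendsto' (tendsto_finsetSum A fun y _ =>
      (hS x y).hasSum.tendsto_sum_nat.mul_const (eqm A y))
      fun N => sum_step_mul_eqm_le_hitProb hd A N x
  set r : V d → ℝ := fun x => hitProb A x - ∑ y ∈ A, green x y * eqm A y with hr
  have hharm : ∀ x, r x = walkAvg r x := by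
    intro x
    rw [hr, walkAvg_sub, walkAvg_sum_mul]
    simp only
    rw [hitProb_eq_eqm_add hd, Finset.sum_congr rfl fun y _ => by rw [hS.green_eq x y, add_mul],
      Finset.sum_add_distrib, sum_ite_eq_mul_eqm]
    ring
  have htail : ∀ N x, r x ≤ ∑ y ∈ A, (∑' n, step d (n + N) x y) * 1 := by
    intro N
    induction N with
    | zero =>
      intro x
      have h1 := hS.hitProb_le_sum_green A x
      have h2 : 0 ≤ ∑ y ∈ A, green x y * eqm A y :=
        Finset.sum_nonneg fun y _ => mul_nonneg (green_nonneg x y) (eqm_nonneg hd A y)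
      simp only [add_zero, mul_one]
      change hitProb A x - _ ≤ ∑ y ∈ A, green x y
      linarith
    | succ N ih =>
      intro x
      rw [hharm]
      refine (walkAvg_mono ih x).trans_eq ?_
      rw [walkAvg_sum_mul]
      simp only [hS.walkAvg_tail]
  have hlim : Tendsto (fun N => ∑ y ∈ A, (∑' n, step d (n + N) x y) * 1) atTop (nhds 0) := by
    have h := tendsto_finsetSum A fun y _ =>
      (tendsto_sum_nat_add fun n => step d n x y).mul_const (1 : ℝ)
    simpa using h
  have h0 : r x ≤ 0 := ge_of_tendsto' hlim fun N => htail N x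
  exact le_antisymm (hle x) (sub_nonpos.1 h0)

lemma Transient.sum_green_mul_eqm_le_one (hS : Transient d) (hd : d ≠ 0) (A : Finset (V d))
    (x : V d) : ∑ y ∈ A, green x y * eqm A y ≤ 1 :=
  (hS.sum_green_mul_eqm hd A x).trans_le (hitProb_le_one hd A x)

lemma Transient.sum_green_mul_eqm_of_mem (hS : Transient d) (hd : d ≠ 0) {A : Finset (V d)}
    {x : V d} (hx : x ∈ A) : ∑ y ∈ A, green x y * eqm A y = 1 :=
  (hS.sum_green_mul_eqm hd A x).trans (hitProb_of_mem hx)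

lemma Transient.capa_pos (hS : Transient d) (hd : d ≠ 0) {A : Finset (V d)} (hA : A.Nonempty) :
    0 < capa A := by
  obtain ⟨x, hx⟩ := hA
  refine (capa_nonneg hd A).lt_of_ne fun h => ?_
  have h0 := (Finset.sum_eq_zero_iff_of_nonneg fun y _ => eqm_nonneg hd A y).1 h.symm
  have h1 := hS.sum_green_mul_eqm_of_mem hd hx
  rw [Finset.sum_eq_zero fun y hy => by rw [h0 y hy, mul_zero]] at h1
  exact zero_ne_one h1

lemma Transient.capa_mono (hS : Transient d) (hd : d ≠ 0) {A B : Finset (V d)} (h : A ⊆ B) :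
    capa A ≤ capa B := by
  calc capa A = ∑ x ∈ A, (∑ y ∈ B, green x y * eqm B y) * eqm A x :=
        Finset.sum_congr rfl fun x hx => by
          rw [hS.sum_green_mul_eqm_of_mem hd (h hx), one_mul]
    _ = ∑ y ∈ B, (∑ x ∈ A, green y x * eqm A x) * eqm B y := by
        simp only [Finset.sum_mul]
        rw [Finset.sum_comm]
        exact Finset.sum_congr rfl fun y _ => Finset.sum_congr rfl fun x _ => by
          rw [green_comm]; ring
    _ ≤ ∑ y ∈ B, 1 * eqm B y := Finset.sum_le_sum fun y _ =>
        mul_le_mul_of_nonneg_right (hS.sum_green_mul_eqm_le_one hd A y) (eqm_nonneg hd B y)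
    _ = capa B := by simp [capa]

/-- Lower bound on the capacity from an upper bound on the potential of the counting measure. -/
lemma Transient.card_le_mul_capa (hS : Transient d) (hd : d ≠ 0) {A : Finset (V d)} {Λ : ℝ}
    (h : ∀ x ∈ A, ∑ y ∈ A, green x y ≤ Λ) : (A.card : ℝ) ≤ Λ * capa A := by
  calc (A.card : ℝ) = ∑ y ∈ A, ∑ x ∈ A, green y x * eqm A x := by
        rw [Finset.sum_congr rfl fun y hy => hS.sum_green_mul_eqm_of_mem hd hy]; simp
    _ = ∑ x ∈ A, (∑ y ∈ A, green x y) * eqm A x := by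
        rw [Finset.sum_comm]
        simp only [Finset.sum_mul]
        exact Finset.sum_congr rfl fun y _ => Finset.sum_congr rfl fun x _ => by
          rw [green_comm]
    _ ≤ ∑ x ∈ A, Λ * eqm A x := Finset.sum_le_sum fun x hx =>
        mul_le_mul_of_nonneg_right (h x hx) (eqm_nonneg hd A x)
    _ = Λ * capa A := by rw [capa, Finset.mul_sum]

/-! ### Boxes -/

lemma mem_box {z x : V d} {L : ℤ} : x ∈ box z L ↔ ∀ i, z i ≤ x i ∧ x i < z i + L := by
  simp [box]

lemma card_box (z : V d) {L : ℤ} (hL : 0 ≤ L) : ((box z L).card : ℝ) = (L : ℝ) ^ d := by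
  lift L to ℕ using hL
  simp [box]

lemma card_ball_le {L : ℤ} (hL : 1 ≤ L) : ((ball (0 : V d) L).card : ℝ) ≤ 3 ^ d * (L : ℝ) ^ d := by
  have hL' : (1 : ℝ) ≤ L := by exact_mod_cast hL
  have h : ((ball (0 : V d) L).card : ℝ) = (2 * (L : ℝ) + 1) ^ d := by
    lift L to ℕ using by omega
    have : (L + 1 + L : ℤ).toNat = 2 * L + 1 := by omega
    simp [ball, this]
  rw [h, ← mul_pow]
  exact pow_le_pow_left₀ (by linarith) (by linarith) d

lemma box_eq_image_add (z : V d) (L : ℤ) : box z L = (box 0 L).image (· + z) := by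
  ext x
  simp only [Finset.mem_image, mem_box]
  refine ⟨fun h => ⟨x - z, fun i => ?_, by simp⟩, ?_⟩
  · have := h i
    simp only [Pi.sub_apply, Pi.zero_apply]
    omega
  · rintro ⟨y, hy, rfl⟩ i
    have := hy i
    simp only [Pi.add_apply, Pi.zero_apply] at *
    omega

/-- A sum over a box is at most the sum over a sup-norm ball centred in this box. -/
lemma sum_box_le_sum_ball {f : V d → ℝ} (hf : ∀ x, 0 ≤ f x) {z x : V d} {L : ℤ}
    (hx : x ∈ box z L) : ∑ y ∈ box z L, f y ≤ ∑ w ∈ ball 0 L, f (x + w) := by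
  rw [← Finset.sum_image (s := ball 0 L) (g := fun w => x + w) (f := f)
    fun a _ b _ h => add_left_cancel h]
  refine Finset.sum_le_sum_of_subset_of_nonneg (fun y hy => ?_) fun y _ _ => hf y
  refine Finset.mem_image.2 ⟨y - x, ?_, by simp⟩
  simp only [ball, Fintype.mem_piFinset, Finset.mem_Icc, Pi.sub_apply, Pi.zero_apply]
  intro i
  have := mem_box.1 hx i
  have := mem_box.1 hy i
  omega

lemma disjoint_box {L : ℤ} {z z' : V d} (hz : ∃ w : V d, z = fun i => L * w i)
    (hz' : ∃ w : V d, z' = fun i => L * w i) (hne : z ≠ z') : Disjoint (box z L) (box z' L) := by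
  obtain ⟨w, rfl⟩ := hz
  obtain ⟨w', rfl⟩ := hz'
  refine Finset.disjoint_left.2 fun x hx hx' => hne ?_
  ext i
  have h := mem_box.1 hx i
  have h' := mem_box.1 hx' i
  have hL : 0 < L := by omega
  have h1 : w i < w' i + 1 := by
    refine lt_of_mul_lt_mul_left ?_ hL.le
    linarith
  have h2 : w' i < w i + 1 := by
    refine lt_of_mul_lt_mul_left ?_ hL.le
    linarith
  have : w i = w' i := by omega
  rw [this]

/-- Mutual Green energy of the counting measures of two boxes. -/
def boxEnergy (L : ℤ) (z z' : V d) : ℝ := ∑ x ∈ box z L, ∑ y ∈ box z' L, green x y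

lemma boxEnergy_comm (L : ℤ) (z z' : V d) : boxEnergy L z z' = boxEnergy L z' z := by
  rw [boxEnergy, Finset.sum_comm, boxEnergy]
  simp only [green_comm]

lemma boxEnergy_self (L : ℤ) (z : V d) : boxEnergy L z z = boxEnergy L (0 : V d) 0 := by
  have hinj : Set.InjOn (· + z) (box (0 : V d) L : Set (V d)) :=
    fun a _ b _ h => add_right_cancel h
  simp only [boxEnergy, box_eq_image_add z, Finset.sum_image hinj, green_add_right]

lemma Transient.boxEnergy_pos (hS : Transient d) {L : ℤ} (hL : 1 ≤ L) :
    0 < boxEnergy L (0 : V d) 0 := by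
  have h0 : (0 : V d) ∈ box (0 : V d) L := mem_box.2 fun i => by simp; omega
  refine Finset.sum_pos (fun x hx => ?_) ⟨0, h0⟩
  exact Finset.sum_pos' (fun y _ => green_nonneg x y)
    ⟨x, hx, zero_lt_one.trans_le (hS.one_le_green_self x)⟩

lemma Transient.sum_eqm_green_ball_le (hS : Transient d) (hd : d ≠ 0) {A : Finset (V d)} {L : ℤ}
    (x : V d) : ∑ u ∈ A, eqm A u * ∑ w ∈ ball 0 L, green x (u + w) ≤ (ball (0 : V d) L).card := by
  calc ∑ u ∈ A, eqm A u * ∑ w ∈ ball 0 L, green x (u + w)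
      = ∑ w ∈ ball 0 L, ∑ u ∈ A, green (x - w) u * eqm A u := by
        simp only [Finset.mul_sum]
        rw [Finset.sum_comm]
        refine Finset.sum_congr rfl fun w _ => Finset.sum_congr rfl fun u _ => ?_
        rw [← green_add_right (x - w) u w, sub_add_cancel, mul_comm]
    _ ≤ ∑ w ∈ ball (0 : V d) L, 1 :=
        Finset.sum_le_sum fun w _ => hS.sum_green_mul_eqm_le_one hd A (x - w)
    _ = _ := by simp

lemma Transient.capa_box_mul_boxEnergy_le (hS : Transient d) (hd : d ≠ 0) {L : ℤ} (hL : 1 ≤ L) :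
    capa (box (0 : V d) L) * boxEnergy L (0 : V d) 0 ≤ 3 ^ d * ((L : ℝ) ^ d) ^ 2 := by
  set B := box (0 : V d) L
  have key : ∀ x, capa B * ∑ y ∈ B, green x y ≤ 3 ^ d * (L : ℝ) ^ d := fun x => by
    refine le_trans ?_ ((hS.sum_eqm_green_ball_le hd (A := B) (L := L) x).trans (card_ball_le hL))
    rw [capa, Finset.sum_mul]
    exact Finset.sum_le_sum fun u hu => mul_le_mul_of_nonneg_left
      (sum_box_le_sum_ball (green_nonneg x) hu) (eqm_nonneg hd B u)
  rw [boxEnergy, Finset.mul_sum]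
  refine (Finset.sum_le_sum fun x _ => key x).trans_eq ?_
  rw [Finset.sum_const, nsmul_eq_mul, card_box _ (by omega)]
  ring

/-! ### Selection of the subfamily -/

/-- Given a symmetric kernel with constant diagonal `a₀`, there is a subset in whose potential every
point of the ambient set has height at least `a₀` and every point of the subset at most `2 a₀`. -/
lemma exists_subset_sum_kernel {ι : Type*} (Z : Finset ι) (a : ι → ι → ℝ) (a₀ : ℝ)
    (hsymm : ∀ i j, a i j = a j i) (hdiag : ∀ i, a i i = a₀) :
    ∃ S ⊆ Z, (∀ i ∈ Z, i ∉ S → a₀ ≤ ∑ j ∈ S, a i j) ∧ ∀ i ∈ S, ∑ j ∈ S, a i j ≤ 2 * a₀ := by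
  set F : Finset ι → ℝ := fun S => 3 * a₀ * S.card - ∑ i ∈ S, ∑ j ∈ S, a i j with hF
  have hins : ∀ S : Finset ι, ∀ i ∉ S, F (insert i S) = F S + 2 * a₀ - 2 * ∑ j ∈ S, a i j := by
    intro S i hi
    simp only [hF, Finset.sum_insert hi, Finset.card_insert_of_notMem hi, Finset.sum_add_distrib,
      hdiag, hsymm _ i]
    push_cast
    ring
  obtain ⟨S, hSZ, hmax⟩ := Finset.exists_max_image Z.powerset F ⟨∅, by simp⟩
  rw [Finset.mem_powerset] at hSZ
  refine ⟨S, hSZ, fun i hi hiS => ?_, fun i hi => ?_⟩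
  · have h := hmax (insert i S) (Finset.mem_powerset.2 (Finset.insert_subset hi hSZ))
    rw [hins S i hiS] at h
    linarith
  · have h := hmax (S.erase i) (Finset.mem_powerset.2 ((Finset.erase_subset i S).trans hSZ))
    have h' := hins (S.erase i) i (Finset.notMem_erase i S)
    rw [Finset.insert_erase hi] at h'
    rw [← Finset.add_sum_erase S _ hi, hdiag]
    linarith

/-- Markov's inequality: a family of cardinality `N` with total potential at most `E` contains at
least `N / 2` points of potential at most `2 E / N`, which bounds the capacity from below. -/
lemma Transient.card_sq_le_energy_mul_capa (hS : Transient d) (hd : d ≠ 0) {A : Finset (V d)}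
    {E : ℝ} (hE : ∑ x ∈ A, ∑ y ∈ A, green x y ≤ E) : (A.card : ℝ) ^ 2 ≤ 4 * E * capa A := by
  rcases A.eq_empty_or_nonempty with rfl | hA
  · simp [capa]
  have hN : (0 : ℝ) < A.card := by exact_mod_cast hA.card_pos
  set f : V d → ℝ := fun x => ∑ y ∈ A, green x y
  have hf0 : ∀ x, 0 ≤ f x := fun x => Finset.sum_nonneg fun y _ => green_nonneg x y
  have hE0 : 0 < E := by
    refine lt_of_lt_of_le (Finset.sum_pos (fun x hx => ?_) hA) hE
    exact Finset.sum_pos' (fun y _ => green_nonneg x y)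
      ⟨x, hx, zero_lt_one.trans_le (hS.one_le_green_self x)⟩
  set Λ : ℝ := 2 * E / A.card with hΛ
  have hΛ0 : 0 < Λ := by positivity
  set G := A.filter (fun x => f x ≤ Λ)
  have hsplit : (G.card : ℝ) + (A.filter (fun x => ¬ f x ≤ Λ)).card = A.card := by
    exact_mod_cast Finset.card_filter_add_card_filter_not (s := A) (fun x => f x ≤ Λ)
  have hbad : (A.filter (fun x => ¬ f x ≤ Λ)).card * Λ ≤ E := by
    calc (A.filter (fun x => ¬ f x ≤ Λ)).card * Λ
        = ∑ x ∈ A.filter (fun x => ¬ f x ≤ Λ), Λ := by simp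
      _ ≤ ∑ x ∈ A.filter (fun x => ¬ f x ≤ Λ), f x := Finset.sum_le_sum fun x hx =>
          (not_le.1 (Finset.mem_filter.1 hx).2).le
      _ ≤ ∑ x ∈ A, f x :=
          Finset.sum_le_sum_of_subset_of_nonneg (Finset.filter_subset _ _) fun x _ _ => hf0 x
      _ ≤ E := hE
  have hgood : (G.card : ℝ) ≤ Λ * capa G := hS.card_le_mul_capa hd fun x hx =>
    (Finset.sum_le_sum_of_subset_of_nonneg (Finset.filter_subset _ _)
      fun y _ _ => green_nonneg x y).trans (Finset.mem_filter.1 hx).2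
  have hmono : Λ * capa G ≤ Λ * capa A :=
    mul_le_mul_of_nonneg_left (hS.capa_mono hd (Finset.filter_subset _ _)) hΛ0.le
  have hΛN : Λ * A.card = 2 * E := by rw [hΛ]; field_simp
  have hbad' : ((A.filter (fun x => ¬ f x ≤ Λ)).card : ℝ) ≤ A.card / 2 := by
    refine le_of_mul_le_mul_right ?_ hΛ0
    linarith
  have hhalf : (A.card : ℝ) / 2 ≤ Λ * capa A := by linarith
  have := mul_le_mul_of_nonneg_right hhalf hN.le
  nlinarith

/-- If the counting measure of `A` has energy at least `a₀` with every box of a family, then the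
capacity of the union of the family is controlled by the cardinality of `A`. -/
lemma Transient.mul_capa_biUnion_box_le (hS : Transient d) (hd : d ≠ 0) {Z A : Finset (V d)}
    {L : ℤ} (hL : 1 ≤ L) {a₀ : ℝ} (h : ∀ z ∈ Z, a₀ ≤ ∑ x ∈ box z L, ∑ y ∈ A, green x y) :
    a₀ * capa (Z.biUnion fun z => box z L) ≤ 3 ^ d * (L : ℝ) ^ d * A.card := by
  set U := Z.biUnion fun z => box z L
  calc a₀ * capa U = ∑ x ∈ U, eqm U x * a₀ := by rw [capa, Finset.mul_sum]; simp only [mul_comm]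
    _ ≤ ∑ x ∈ U, eqm U x * ∑ w ∈ ball 0 L, ∑ y ∈ A, green (x + w) y := by
        refine Finset.sum_le_sum fun x hx => mul_le_mul_of_nonneg_left ?_ (eqm_nonneg hd U x)
        obtain ⟨z, hz, hxz⟩ := Finset.mem_biUnion.1 hx
        exact (h z hz).trans (sum_box_le_sum_ball (f := fun x => ∑ y ∈ A, green x y)
          (fun x => Finset.sum_nonneg fun y _ => green_nonneg x y) hxz)
    _ = ∑ y ∈ A, ∑ x ∈ U, eqm U x * ∑ w ∈ ball 0 L, green y (x + w) := by
        rw [Finset.sum_comm]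
        refine Finset.sum_congr rfl fun x _ => ?_
        rw [Finset.sum_comm, Finset.mul_sum]
        simp only [green_comm]
    _ ≤ ∑ y ∈ A, 3 ^ d * (L : ℝ) ^ d := Finset.sum_le_sum fun y _ =>
        (hS.sum_eqm_green_ball_le hd y).trans (card_ball_le hL)
    _ = _ := by rw [Finset.sum_const, nsmul_eq_mul, mul_comm]

/-- abstract form of Lemma 1.2, after Asselah–Schapira: if `Ã` is a
union of `B₀`-boxes of side `L₀` with base points in `L₀ℤ^d` at mutual sup-norm
distance at least `K̄L₀`, then (for `K̄` and the scales large enough depending only on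
`d`) one can find a subunion `A' ⊆ Ã` with `cap(A') ≥ c·cap(Ã)` whose number of
boxes `|A'|/|B₀|` is at most `c'·cap(Ã)/cap(B₀)`. -/
theorem cost_bubble_stmt17 (d : ℕ) (hd : 3 ≤ d) :
    ∃ c > (0 : ℝ), ∃ c' > (0 : ℝ), ∃ C : ℕ, 0 < C ∧
      ∀ (Kb L₀ : ℤ), (C : ℤ) ≤ Kb → (C : ℤ) ≤ L₀ →
      ∀ Z : Finset (V d),
        (∀ z ∈ Z, ∃ w : V d, z = fun i => L₀ * w i) →
        (∀ z ∈ Z, ∀ z' ∈ Z, z ≠ z' → Kb * L₀ ≤ (supNorm (z - z') : ℤ)) →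
        ∃ Z' ⊆ Z,
          c * capa (Z.biUnion fun z => box z L₀) ≤ capa (Z'.biUnion fun z => box z L₀) ∧
          (Z'.card : ℝ) ≤ c' * capa (Z.biUnion fun z => box z L₀) / capa (box (0 : V d) L₀) := by
  have hd0 : d ≠ 0 := by omega
  refine ⟨1 / (8 * 3 ^ d), by positivity, 8 * 3 ^ d, by positivity, 1, one_pos, ?_⟩
  intro _ L _ hL Z hZ _
  have hL1 : 1 ≤ L := by exact_mod_cast hL
  by_cases hcap : ∃ A : Finset (V d), 0 < capa A
  swap
  · have h0 : ∀ A : Finset (V d), capa A = 0 := fun A =>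
      le_antisymm (not_lt.1 fun h => hcap ⟨A, h⟩) (capa_nonneg hd0 A)
    exact ⟨∅, Finset.empty_subset Z, by simp [h0]⟩
  obtain ⟨A, hA⟩ := hcap
  have hS := transient_of_capa_pos hd0 hA
  set a₀ := boxEnergy L (0 : V d) 0
  have ha₀pos : 0 < a₀ := hS.boxEnergy_pos hL1
  obtain ⟨S, hSZ, hout, hin⟩ := exists_subset_sum_kernel Z (boxEnergy L) a₀
    (boxEnergy_comm L) (boxEnergy_self L)
  set U := Z.biUnion fun z => box z L
  set U' := S.biUnion fun z => box z L with hU'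
  have hdisj : (S : Set (V d)).PairwiseDisjoint fun z => box z L := fun z hz z' hz' hne =>
    disjoint_box (hZ z (hSZ hz)) (hZ z' (hSZ hz')) hne
  have hpot : ∀ z, ∑ x ∈ box z L, ∑ y ∈ U', green x y = ∑ z' ∈ S, boxEnergy L z z' := by
    intro z
    simp only [boxEnergy, hU', Finset.sum_biUnion hdisj]
    exact Finset.sum_comm
  have hLd : (0 : ℝ) < (L : ℝ) ^ d := pow_pos (by exact_mod_cast hL1) d
  have hcard : (U'.card : ℝ) = S.card * (L : ℝ) ^ d := by
    rw [hU', Finset.card_biUnion hdisj]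
    push_cast
    simp [card_box _ (zero_le_one.trans hL1)]
  have hall : ∀ z ∈ Z, a₀ ≤ ∑ x ∈ box z L, ∑ y ∈ U', green x y := by
    intro z hz
    rw [hpot]
    by_cases hzS : z ∈ S
    · refine (boxEnergy_self L z).symm.le.trans
        (Finset.single_le_sum (f := boxEnergy L z) (fun z' _ => ?_) hzS)
      exact Finset.sum_nonneg fun x _ => Finset.sum_nonneg fun y _ => green_nonneg x y
    · exact hout z hz hzS
  have hupper := hS.mul_capa_biUnion_box_le hd0 hL1 hall
  have hE : ∑ x ∈ U', ∑ y ∈ U', green x y ≤ S.card * (2 * a₀) := by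
    conv_lhs => rw [hU', Finset.sum_biUnion hdisj]
    rw [← nsmul_eq_mul, ← Finset.sum_const]
    exact Finset.sum_le_sum fun z hz => (hpot z).trans_le (hin z hz)
  have hlower := hS.card_sq_le_energy_mul_capa hd0 hE
  have hbox := hS.capa_box_mul_boxEnergy_le hd0 hL1
  have hB : 0 < capa (box (0 : V d) L) :=
    hS.capa_pos hd0 ⟨0, mem_box.2 fun i => by simp; omega⟩
  have hmono : capa U' ≤ capa U := hS.capa_mono hd0
    (Finset.biUnion_subset_biUnion_of_subset_left _ hSZ)
  rw [hcard] at hupper hlower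
  set b := (L : ℝ) ^ d
  have hsel : S.card * b ^ 2 ≤ 8 * a₀ * capa U' := by
    rcases Nat.eq_zero_or_pos S.card with h | h
    · rw [h, Nat.cast_zero, zero_mul]
      have := capa_nonneg hd0 U'
      positivity
    · have h' : (0 : ℝ) < S.card := by exact_mod_cast h
      refine le_of_mul_le_mul_left ?_ h'
      linarith
  refine ⟨S, hSZ, ?_, ?_⟩
  · rw [one_div_mul_eq_div, div_le_iff₀ (by positivity)]
    refine le_of_mul_le_mul_left ?_ ha₀pos
    have := mul_le_mul_of_nonneg_left hsel (show (0 : ℝ) ≤ 3 ^ d by positivity)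
    linarith
  · rw [le_div_iff₀ hB]
    have hb2 : 0 < b ^ 2 := by positivity
    refine le_of_mul_le_mul_right ?_ hb2
    have h1 := mul_le_mul_of_nonneg_right
      (hsel.trans (mul_le_mul_of_nonneg_left hmono (by positivity))) hB.le
    have h2 := mul_le_mul_of_nonneg_right hbox
      (mul_nonneg (by norm_num : (0 : ℝ) ≤ 8) (capa_nonneg hd0 U))
    linarith

end
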